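/- Let F be a field, q ∈ F and f, g ∈ F[h] with deg f > 1. Then the centralizer of h in the quantum generalized Heisenberg algebra H_q(f,g) equals the degree-0 component H_0 = ⊕_{i≥0} x^i F[h] y^i of the ℤ-grading. -/

import Mathlib

open Polynomial

/-- The three generators `x`, `y`, `h` of a quantum generalized Heisenberg algebra. -/
inductive QGHAGen : Type
  | x : QGHAGen
  | y : QGHAGen
  | h : QGHAGen

/-- The defining relations of the quantum generalized Heisenberg algebra `H_q(f,g)`:
`h*x = x*f(h)`, `y*h = f(h)*y`, and `y*x - q*(x*y) = g(h)`. -/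
inductive QGHARel (F : Type*) [Field F] (q : F) (f g : F[X]) :
    FreeAlgebra F QGHAGen → FreeAlgebra F QGHAGen → Prop
  | hx : QGHARel F q f g
      (FreeAlgebra.ι F QGHAGen.h * FreeAlgebra.ι F QGHAGen.x)
      (FreeAlgebra.ι F QGHAGen.x * aeval (FreeAlgebra.ι F QGHAGen.h) f)
  | yh : QGHARel F q f g
      (FreeAlgebra.ι F QGHAGen.y * FreeAlgebra.ι F QGHAGen.h)
      (aeval (FreeAlgebra.ι F QGHAGen.h) f * FreeAlgebra.ι F QGHAGen.y)
  | yx : QGHARel F q f g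
      (FreeAlgebra.ι F QGHAGen.y * FreeAlgebra.ι F QGHAGen.x)
      (q • (FreeAlgebra.ι F QGHAGen.x * FreeAlgebra.ι F QGHAGen.y)
        + aeval (FreeAlgebra.ι F QGHAGen.h) g)

/-- The quantum generalized Heisenberg algebra `H_q(f,g)`. -/
def QGHA (F : Type*) [Field F] (q : F) (f g : F[X]) : Type _ :=
  RingQuot (QGHARel F q f g)

namespace QGHA

variable {F : Type*} [Field F] (q : F) (f g : F[X])

instance : Ring (QGHA F q f g) :=
  inferInstanceAs (Ring (RingQuot (QGHARel F q f g)))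

instance : Algebra F (QGHA F q f g) :=
  inferInstanceAs (Algebra F (RingQuot (QGHARel F q f g)))

/-- The generator `x` of `H_q(f,g)`. -/
def x : QGHA F q f g :=
  RingQuot.mkAlgHom F (QGHARel F q f g) (FreeAlgebra.ι F QGHAGen.x)

/-- The generator `y` of `H_q(f,g)`. -/
def y : QGHA F q f g :=
  RingQuot.mkAlgHom F (QGHARel F q f g) (FreeAlgebra.ι F QGHAGen.y)

/-- The generator `h` of `H_q(f,g)`. -/
def h : QGHA F q f g :=
  RingQuot.mkAlgHom F (QGHARel F q f g) (FreeAlgebra.ι F QGHAGen.h)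

end QGHA

/-- The subspace `x^i F[h] y^j` of `H_q(f,g)`. -/
noncomputable def QGHA.Mij {F : Type*} [Field F] (q : F) (f g : F[X]) (i j : ℕ) :
    Submodule F (QGHA F q f g) :=
  Submodule.span F
    {a | ∃ p : F[X], a = QGHA.x q f g ^ i * aeval (QGHA.h q f g) p * QGHA.y q f g ^ j}

/-- The degree-`k` component of the ℤ-grading of `H_q(f,g)` in which `x` has degree `1`,
`h` has degree `0` and `y` has degree `−1`. -/
noncomputable def QGHA.grading {F : Type*} [Field F] (q : F) (f g : F[X]) (k : ℤ) :
    Submodule F (QGHA F q f g) :=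
  ⨆ (i : ℕ) (j : ℕ) (_ : (i : ℤ) - (j : ℤ) = k), QGHA.Mij q f g i j

namespace QGHA

section Iterates

variable {F : Type*} [Field F]

/-- The `i`-fold composition `f ∘ ⋯ ∘ f`. -/
noncomputable def iter (f : F[X]) (i : ℕ) : F[X] := f.comp^[i] X

@[simp] lemma iter_zero (f : F[X]) : iter f 0 = X := rfl

lemma iter_succ (f : F[X]) (i : ℕ) : iter f (i + 1) = f.comp (iter f i) :=
  Function.iterate_succ_apply' _ _ _

lemma iter_comp (f : F[X]) (i : ℕ) : (iter f i).comp f = iter f (i + 1) := by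
  induction i with
  | zero => simp [iter_succ]
  | succ i ih => rw [iter_succ, comp_assoc, ih, iter_succ f (i + 1)]

lemma natDegree_iter (f : F[X]) (i : ℕ) : (iter f i).natDegree = f.natDegree ^ i := by
  induction i with
  | zero => simp
  | succ i ih => rw [iter_succ, natDegree_comp, ih, pow_succ']

lemma iter_injective {f : F[X]} (hf : 1 < f.degree) : Function.Injective (iter f) := by
  intro i j hij
  have hd : 1 < f.natDegree := by
    rw [← natDegree_X (R := F)]
    exact natDegree_lt_natDegree X_ne_zero (by rwa [degree_X])
  refine Nat.pow_right_injective hd ?_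
  simpa only [natDegree_iter] using congrArg natDegree hij

/-- The polynomial `G_i` in the identity `y x^i = q^i x^i y + x^(i-1) G_i(h)`. -/
noncomputable def commCoeff (q : F) (f g : F[X]) : ℕ → F[X]
  | 0 => 0
  | i + 1 => q • commCoeff q f g i + g.comp (iter f i)

lemma commCoeff_succ (q : F) (f g : F[X]) (i : ℕ) :
    commCoeff q f g (i + 1) = q • commCoeff q f g i + g.comp (iter f i) := rfl

end Iterates

section Representation

variable {F : Type*} [Field F] (q : F) (f g : F[X])

/-- The action of `x` on coefficient arrays. -/
noncomputable def opX : Module.End F (ℕ → ℕ → F[X]) where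
  toFun v i j := match i with
    | 0 => 0
    | i + 1 => v i j
  map_add' v w := by
    funext i j
    cases i <;> simp
  map_smul' c v := by
    funext i j
    cases i <;> simp

/-- The action of `h` on coefficient arrays. -/
noncomputable def opH : Module.End F (ℕ → ℕ → F[X]) where
  toFun v i j := iter f i * v i j
  map_add' v w := by
    funext i j
    simp [mul_add]
  map_smul' c v := by
    funext i j
    simp

/-- The action of `y` on coefficient arrays. -/
noncomputable def opY : Module.End F (ℕ → ℕ → F[X]) where
  toFun v i j := (match j with
    | 0 => 0
    | j + 1 => q ^ i • (v i j).comp f) + commCoeff q f g (i + 1) * v (i + 1) j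
  map_add' v w := by
    funext i j
    cases j
    · simp [mul_add]
    · simp only [Pi.add_apply, add_comp, smul_add, mul_add]
      abel
  map_smul' c v := by
    funext i j
    cases j
    · simp
    · simp [smul_comp, smul_comm c]

/-- The operator of right multiplication by `h` on coefficient arrays. -/
noncomputable def opR : Module.End F (ℕ → ℕ → F[X]) where
  toFun v i j := v i j * iter f j
  map_add' v w := by
    funext i j
    simp [add_mul]
  map_smul' c v := by
    funext i j
    simp

@[simp] lemma opX_zero (v : ℕ → ℕ → F[X]) (j : ℕ) : opX v 0 j = 0 := rfl

@[simp] lemma opX_succ (v : ℕ → ℕ → F[X]) (i j : ℕ) : opX v (i + 1) j = v i j := rfl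

@[simp] lemma opH_apply (v : ℕ → ℕ → F[X]) (i j : ℕ) : opH f v i j = iter f i * v i j := rfl

@[simp] lemma opY_zero (v : ℕ → ℕ → F[X]) (i : ℕ) :
    opY q f g v i 0 = commCoeff q f g (i + 1) * v (i + 1) 0 := zero_add _

@[simp] lemma opY_succ (v : ℕ → ℕ → F[X]) (i j : ℕ) :
    opY q f g v i (j + 1) =
      q ^ i • (v i j).comp f + commCoeff q f g (i + 1) * v (i + 1) (j + 1) := rfl

@[simp] lemma opR_apply (v : ℕ → ℕ → F[X]) (i j : ℕ) : opR f v i j = v i j * iter f j := rfl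

lemma aeval_opH_apply (p : F[X]) (v : ℕ → ℕ → F[X]) (i j : ℕ) :
    aeval (opH f) p v i j = p.comp (iter f i) * v i j := by
  induction p using Polynomial.induction_on' generalizing v with
  | add p r hp hr => simp [hp, hr, add_mul]
  | monomial n c =>
    induction n generalizing v with
    | zero => simp [Module.algebraMap_end_apply, smul_eq_C_mul]
    | succ n ih =>
      rw [← monomial_mul_X, map_mul, aeval_X, Module.End.mul_apply, ih, opH_apply, mul_comp, X_comp,
        mul_assoc]

/-- The images of the generators in the representation on coefficient arrays. -/
noncomputable def genOp : QGHAGen → Module.End F (ℕ → ℕ → F[X])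
  | .x => opX
  | .y => opY q f g
  | .h => opH f

lemma lift_genOp_aeval (p : F[X]) :
    FreeAlgebra.lift F (genOp q f g) (aeval (FreeAlgebra.ι F QGHAGen.h) p) =
      aeval (opH f) p := by
  rw [← aeval_algHom_apply, FreeAlgebra.lift_ι_apply, genOp]

lemma lift_genOp_rel ⦃a b : FreeAlgebra F QGHAGen⦄ (hab : QGHARel F q f g a b) :
    FreeAlgebra.lift F (genOp q f g) a = FreeAlgebra.lift F (genOp q f g) b := by
  cases hab with
  | hx =>
    rw [map_mul, map_mul, lift_genOp_aeval, FreeAlgebra.lift_ι_apply, FreeAlgebra.lift_ι_apply]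
    refine LinearMap.ext fun v => funext₂ fun i j => ?_
    cases i <;> simp [genOp, aeval_opH_apply, iter_succ]
  | yh =>
    rw [map_mul, map_mul, lift_genOp_aeval, FreeAlgebra.lift_ι_apply, FreeAlgebra.lift_ι_apply]
    refine LinearMap.ext fun v => funext₂ fun i j => ?_
    cases j <;> simp [genOp, aeval_opH_apply, iter_comp, ← iter_succ, smul_eq_C_mul] <;> ring
  | yx =>
    rw [map_mul, map_add, map_smul, map_mul, lift_genOp_aeval, FreeAlgebra.lift_ι_apply,
      FreeAlgebra.lift_ι_apply]
    refine LinearMap.ext fun v => funext₂ fun i j => ?_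
    cases i <;> cases j <;>
      simp [genOp, aeval_opH_apply, commCoeff, pow_succ', mul_smul, smul_eq_C_mul] <;> ring

/-- The quotient map from the free algebra onto `H_q(f,g)`. -/
noncomputable def mk : FreeAlgebra F QGHAGen →ₐ[F] QGHA F q f g :=
  RingQuot.mkAlgHom F (QGHARel F q f g)

lemma mk_surjective : Function.Surjective (mk q f g) :=
  RingQuot.mkAlgHom_surjective F (QGHARel F q f g)

lemma mk_rel {a b : FreeAlgebra F QGHAGen} (hab : QGHARel F q f g a b) :
    mk q f g a = mk q f g b :=
  RingQuot.mkAlgHom_rel F hab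

/-- The representation of `H_q(f,g)` on coefficient arrays. -/
noncomputable def rep : QGHA F q f g →ₐ[F] Module.End F (ℕ → ℕ → F[X]) :=
  RingQuot.liftAlgHom F ⟨FreeAlgebra.lift F (genOp q f g), lift_genOp_rel q f g⟩

lemma rep_mk (a : FreeAlgebra F QGHAGen) :
    rep q f g (mk q f g a) = FreeAlgebra.lift F (genOp q f g) a :=
  RingQuot.liftAlgHom_mkAlgHom_apply _ _ _ _

@[simp] lemma rep_x : rep q f g (x q f g) = opX :=
  (rep_mk q f g _).trans (FreeAlgebra.lift_ι_apply _ _)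

@[simp] lemma rep_y : rep q f g (y q f g) = opY q f g :=
  (rep_mk q f g _).trans (FreeAlgebra.lift_ι_apply _ _)

@[simp] lemma rep_h : rep q f g (h q f g) = opH f :=
  (rep_mk q f g _).trans (FreeAlgebra.lift_ι_apply _ _)

lemma adjoin_generators : Algebra.adjoin F {x q f g, y q f g, h q f g} = ⊤ := by
  have hs : ({x q f g, y q f g, h q f g} : Set (QGHA F q f g)) =
      mk q f g '' Set.range (FreeAlgebra.ι F) := by
    ext a
    constructor
    · rintro (rfl | rfl | rfl)
      exacts [⟨_, ⟨.x, rfl⟩, rfl⟩, ⟨_, ⟨.y, rfl⟩, rfl⟩, ⟨_, ⟨.h, rfl⟩, rfl⟩]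
    · rintro ⟨_, ⟨_ | _ | _, rfl⟩, rfl⟩
      exacts [Or.inl rfl, Or.inr (Or.inl rfl), Or.inr (Or.inr rfl)]
  rw [hs, ← AlgHom.map_adjoin, FreeAlgebra.adjoin_range_ι, Algebra.map_top, AlgHom.range_eq_top]
  exact mk_surjective q f g

lemma rep_commute_opR (a : QGHA F q f g) : Commute (rep q f g a) (opR f) := by
  have ha : a ∈ (Subalgebra.centralizer F {opR f}).comap (rep q f g) := by
    have hle : Algebra.adjoin F {x q f g, y q f g, h q f g} ≤
        (Subalgebra.centralizer F {opR f}).comap (rep q f g) := by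
      refine Algebra.adjoin_le ?_
      rintro _ (rfl | rfl | rfl) <;>
        simp only [SetLike.mem_coe, Subalgebra.mem_comap, rep_x, rep_y, rep_h,
          Subalgebra.mem_centralizer_iff, Set.mem_singleton_iff, forall_eq] <;>
        refine LinearMap.ext fun v => funext₂ fun i j => ?_
      · cases i <;> simp
      · cases j <;> simp [iter_comp, smul_eq_C_mul] <;> ring
      · simp [mul_assoc]
    exact hle (adjoin_generators q f g ▸ Algebra.mem_top)
  exact (Subalgebra.mem_centralizer_iff F |>.1 ha _ rfl).symm

/-- The coefficient array of `x^i p(h) y^j`. -/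
noncomputable def arr (i j : ℕ) (p : F[X]) : ℕ → ℕ → F[X] := Pi.single i (Pi.single j p)

/-- The coefficients of an element of `H_q(f,g)` with respect to the monomials `x^i h^k y^j`. -/
noncomputable def coeff : QGHA F q f g →ₗ[F] (ℕ → ℕ → F[X]) :=
  (LinearMap.applyₗ (arr 0 0 1)).comp (rep q f g).toLinearMap

lemma coeff_apply (a : QGHA F q f g) : coeff q f g a = rep q f g a (arr 0 0 1) := rfl

lemma coeff_h_mul (a : QGHA F q f g) (i j : ℕ) :
    coeff q f g (h q f g * a) i j = iter f i * coeff q f g a i j := by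
  simp [coeff_apply]

lemma coeff_mul_h (a : QGHA F q f g) (i j : ℕ) :
    coeff q f g (a * h q f g) i j = coeff q f g a i j * iter f j := by
  have he : opH f (arr 0 0 1) = opR f (arr 0 0 1) := by
    funext i j
    cases i <;> cases j <;> simp [arr]
  rw [coeff_apply, map_mul, rep_h, Module.End.mul_apply, he, ← Module.End.mul_apply,
    (rep_commute_opR q f g a).eq]
  rfl

lemma coeff_monomial (i j : ℕ) (p : F[X]) :
    coeff q f g (x q f g ^ i * aeval (h q f g) p * y q f g ^ j) = arr i j p := by
  have hy : ∀ j, (opY q f g ^ j) (arr 0 0 1) = arr 0 j 1 := by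
    intro j
    induction j with
    | zero => simp
    | succ j ih =>
      rw [pow_succ', Module.End.mul_apply, ih]
      funext k l
      cases k <;> cases l <;> simp [arr, Pi.single_apply]
      split_ifs <;> simp
  have hp : aeval (opH f) p (arr 0 j 1) = arr 0 j p := by
    funext k l
    rw [aeval_opH_apply]
    cases k <;> simp [arr, Pi.single_apply]
  have hx : (opX ^ i) (arr 0 j p) = arr i j p := by
    induction i with
    | zero => simp
    | succ i ih =>
      rw [pow_succ', Module.End.mul_apply, ih]
      funext k l
      cases k <;> simp [arr, Pi.single_apply]
  rw [coeff_apply]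
  simp only [map_mul, map_pow, rep_x, rep_y, ← aeval_algHom_apply, rep_h, Module.End.mul_apply, hy,
    hp, hx]

end Representation

section NormalForm

variable {F : Type*} [Field F] (q : F) (f g : F[X])

lemma mk_aeval (p : F[X]) :
    mk q f g (aeval (FreeAlgebra.ι F QGHAGen.h) p) =
      aeval (h q f g) p :=
  (aeval_algHom_apply _ _ _).symm

lemma h_mul_x : h q f g * x q f g = x q f g * aeval (h q f g) f := by
  have hr := mk_rel q f g .hx
  rw [map_mul, map_mul, mk_aeval] at hr
  exact hr

lemma y_mul_h : y q f g * h q f g = aeval (h q f g) f * y q f g := by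
  have hr := mk_rel q f g .yh
  rw [map_mul, map_mul, mk_aeval] at hr
  exact hr

lemma y_mul_x :
    y q f g * x q f g = q • (x q f g * y q f g) + aeval (h q f g) g := by
  have hr := mk_rel q f g .yx
  rw [map_mul, map_add, map_smul, map_mul, mk_aeval] at hr
  exact hr

/-- Polynomials pass through an element that intertwines two elements. -/
lemma _root_.SemiconjBy.aeval_right {A : Type*} [Ring A] [Algebra F A] {a b c : A}
    (habc : SemiconjBy a b c) (p : F[X]) : SemiconjBy a (aeval b p) (aeval c p) := by
  induction p using Polynomial.induction_on' with
  | add p r hp hr => simpa using hp.add_right hr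
  | monomial n c =>
    simpa [aeval_monomial] using
      SemiconjBy.mul_right (Algebra.commutes c a).symm (habc.pow_right n)

lemma aeval_mul_x (p : F[X]) :
    aeval (h q f g) p * x q f g = x q f g * aeval (h q f g) (p.comp f) := by
  rw [aeval_comp]
  exact (SemiconjBy.aeval_right (h_mul_x q f g).symm p).symm

lemma y_mul_aeval (p : F[X]) :
    y q f g * aeval (h q f g) p = aeval (h q f g) (p.comp f) * y q f g := by
  rw [aeval_comp]
  exact SemiconjBy.aeval_right (y_mul_h q f g) p

lemma aeval_mul_x_pow (p : F[X]) (i : ℕ) :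
    aeval (h q f g) p * x q f g ^ i = x q f g ^ i * aeval (h q f g) (p.comp (iter f i)) := by
  induction i with
  | zero => simp
  | succ i ih =>
    rw [pow_succ, ← mul_assoc, ih, mul_assoc, aeval_mul_x, comp_assoc, iter_comp, mul_assoc]

lemma y_pow_mul_h (j : ℕ) :
    y q f g ^ j * h q f g = aeval (h q f g) (iter f j) * y q f g ^ j := by
  induction j with
  | zero => simp
  | succ j ih => rw [pow_succ', mul_assoc, ih, ← mul_assoc, y_mul_aeval, iter_comp, mul_assoc]

lemma y_mul_x_pow_succ (i : ℕ) :
    y q f g * x q f g ^ (i + 1) = q ^ (i + 1) • (x q f g ^ (i + 1) * y q f g) +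
      x q f g ^ i * aeval (h q f g) (commCoeff q f g (i + 1)) := by
  induction i with
  | zero => simp [commCoeff, y_mul_x]
  | succ i ih =>
    rw [pow_succ' (x q f g) (i + 1), ← mul_assoc, y_mul_x, add_mul, aeval_mul_x_pow, smul_mul_assoc,
      mul_assoc, ih, commCoeff_succ q f g (i + 1), map_add, map_smul]
    simp only [mul_add, smul_add, mul_smul_comm, smul_smul, ← mul_assoc, ← pow_succ']
    rw [add_assoc]

/-- The linear map sending a finitely supported coefficient array to the corresponding sum of
elements `x^i p_{ij}(h) y^j`. -/
noncomputable def ofCoeff : (ℕ × ℕ →₀ F[X]) →ₗ[F] QGHA F q f g :=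
  Finsupp.lsum F fun ij =>
    (LinearMap.mulRight F (y q f g ^ ij.2)).comp
      ((LinearMap.mulLeft F (x q f g ^ ij.1)).comp (aeval (h q f g)).toLinearMap)

lemma ofCoeff_single (i j : ℕ) (p : F[X]) :
    ofCoeff q f g (Finsupp.single (i, j) p) =
      x q f g ^ i * aeval (h q f g) p * y q f g ^ j := by
  simp [ofCoeff]

lemma monomial_mem_range (i j : ℕ) (p : F[X]) :
    x q f g ^ i * aeval (h q f g) p * y q f g ^ j ∈ (ofCoeff q f g).range :=
  ⟨_, ofCoeff_single q f g i j p⟩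

lemma mul_mem_range_of_monomial {b : QGHA F q f g}
    (hb : ∀ (i j : ℕ) (p : F[X]), b * (x q f g ^ i * aeval (h q f g) p * y q f g ^ j) ∈
      (ofCoeff q f g).range)
    {a : QGHA F q f g} (ha : a ∈ (ofCoeff q f g).range) : b * a ∈ (ofCoeff q f g).range := by
  obtain ⟨s, rfl⟩ := ha
  induction s using Finsupp.induction_linear with
  | zero => simp
  | add s t hs ht =>
    rw [map_add, mul_add]
    exact add_mem hs ht
  | single ij p =>
    rw [ofCoeff_single]
    exact hb _ _ _

lemma x_mul_mem_range {a : QGHA F q f g} (ha : a ∈ (ofCoeff q f g).range) :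
    x q f g * a ∈ (ofCoeff q f g).range := by
  refine mul_mem_range_of_monomial q f g (fun i j p => ?_) ha
  rw [← mul_assoc, ← mul_assoc, ← pow_succ']
  exact monomial_mem_range q f g _ _ _

lemma h_mul_mem_range {a : QGHA F q f g} (ha : a ∈ (ofCoeff q f g).range) :
    h q f g * a ∈ (ofCoeff q f g).range := by
  refine mul_mem_range_of_monomial q f g (fun i j p => ?_) ha
  have hx := aeval_mul_x_pow q f g X i
  rw [aeval_X] at hx
  rw [← mul_assoc, ← mul_assoc, hx, mul_assoc (x q f g ^ i), ← map_mul]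
  exact monomial_mem_range q f g _ _ _

lemma y_mul_mem_range {a : QGHA F q f g} (ha : a ∈ (ofCoeff q f g).range) :
    y q f g * a ∈ (ofCoeff q f g).range := by
  refine mul_mem_range_of_monomial q f g (fun i j p => ?_) ha
  have hxy (i : ℕ) : x q f g ^ i * y q f g * aeval (h q f g) p * y q f g ^ j ∈
      (ofCoeff q f g).range := by
    rw [mul_assoc (x q f g ^ i), y_mul_aeval, ← mul_assoc, mul_assoc _ (y q f g), ← pow_succ']
    exact monomial_mem_range q f g _ _ _
  rw [← mul_assoc, ← mul_assoc]
  cases i with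
  | zero => simpa using hxy 0
  | succ i =>
    rw [y_mul_x_pow_succ, add_mul, add_mul, smul_mul_assoc, smul_mul_assoc, mul_assoc (x q f g ^ i),
      ← map_mul]
    exact add_mem (Submodule.smul_mem _ _ (hxy _)) (monomial_mem_range q f g _ _ _)

lemma ofCoeff_surjective : Function.Surjective (ofCoeff q f g) := by
  intro a
  have ha : a ∈ Algebra.adjoin F {x q f g, y q f g, h q f g} :=
    adjoin_generators q f g ▸ Algebra.mem_top
  suffices hmul : ∀ b ∈ (ofCoeff q f g).range, a * b ∈ (ofCoeff q f g).range by
    simpa using hmul 1 (by simpa using monomial_mem_range q f g 0 0 1)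
  induction ha using Algebra.adjoin_induction with
  | mem a ha =>
    rcases ha with rfl | rfl | rfl
    exacts [fun _ => x_mul_mem_range q f g, fun _ => y_mul_mem_range q f g,
      fun _ => h_mul_mem_range q f g]
  | algebraMap c =>
    intro b hb
    rw [← Algebra.smul_def]
    exact Submodule.smul_mem _ _ hb
  | add a a' _ _ ha ha' =>
    intro b hb
    rw [add_mul]
    exact add_mem (ha b hb) (ha' b hb)
  | mul a a' _ _ ha ha' =>
    intro b hb
    rw [mul_assoc]
    exact ha _ (ha' b hb)

lemma coeff_ofCoeff (s : ℕ × ℕ →₀ F[X]) (i j : ℕ) :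
    coeff q f g (ofCoeff q f g s) i j = s (i, j) := by
  induction s using Finsupp.induction_linear with
  | zero => simp
  | add s t hs ht => simp [hs, ht]
  | single kl p =>
    obtain ⟨k, l⟩ := kl
    rw [ofCoeff_single, coeff_monomial, Finsupp.single_apply]
    by_cases hk : i = k
    · subst hk
      simp [arr, Pi.single_apply, eq_comm]
    · simp [arr, hk, Ne.symm hk]

lemma coeff_eq_zero_of_commute (hf : 1 < f.degree) {a : QGHA F q f g}
    (ha : h q f g * a = a * h q f g) {i j : ℕ} (hij : i ≠ j) : coeff q f g a i j = 0 := by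
  have hc : iter f i * coeff q f g a i j = coeff q f g a i j * iter f j := by
    rw [← coeff_h_mul, ha, coeff_mul_h]
  have hz : (iter f i - iter f j) * coeff q f g a i j = 0 := by
    rw [sub_mul, hc, mul_comm, sub_self]
  exact (mul_eq_zero.1 hz).resolve_left (sub_ne_zero.2 fun he => hij (iter_injective hf he))

lemma centralizer_h (hf : 1 < f.degree) :
    Subalgebra.toSubmodule (Subalgebra.centralizer F {h q f g}) = ⨆ i : ℕ, Mij q f g i i := by
  apply le_antisymm
  · intro a ha
    have hcomm : h q f g * a = a * h q f g := (Subalgebra.mem_centralizer_iff F).1 ha _ rfl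
    obtain ⟨s, rfl⟩ := ofCoeff_surjective q f g a
    rw [← Finsupp.sum_single s, Finsupp.sum, map_sum]
    refine sum_mem fun ij hij => ?_
    obtain ⟨i, j⟩ := ij
    have hd : i = j := by
      by_contra hne
      apply Finsupp.mem_support_iff.1 hij
      rw [← coeff_ofCoeff q f g s, coeff_eq_zero_of_commute q f g hf hcomm hne]
    subst hd
    rw [ofCoeff_single]
    exact Submodule.mem_iSup_of_mem i (Submodule.subset_span ⟨_, rfl⟩)
  · refine iSup_le fun i => Submodule.span_le.2 ?_
    rintro _ ⟨p, rfl⟩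
    refine (Subalgebra.mem_centralizer_iff F).2 ?_
    rintro _ rfl
    have hx := aeval_mul_x_pow q f g X i
    rw [aeval_X, X_comp] at hx
    rw [mul_assoc _ (y q f g ^ i), y_pow_mul_h, ← mul_assoc, ← mul_assoc, ← mul_assoc, hx,
      mul_assoc (x q f g ^ i), mul_assoc (x q f g ^ i) (aeval _ p), ← map_mul, ← map_mul,
      mul_comm p]

lemma grading_zero : grading q f g 0 = ⨆ i : ℕ, Mij q f g i i := by
  apply le_antisymm
  · refine iSup_le fun i => iSup_le fun j => iSup_le fun hij => ?_
    obtain rfl : i = j := by omega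
    exact le_iSup (fun i => Mij q f g i i) i
  · exact iSup_le fun i => le_iSup_of_le i (le_iSup_of_le i (le_iSup_of_le (sub_self _) le_rfl))

end NormalForm

end QGHA

/-- If `deg f > 1`, then the centralizer of `h` in `H_q(f,g)` equals the
degree-`0` component `H_0 = ⊕_{i≥0} x^i F[h] y^i` of the ℤ-grading. -/
theorem qgha_centralizer_h {F : Type*} [Field F] (q : F) (f g : F[X])
    (hf : 1 < f.degree) :
    Subalgebra.toSubmodule (Subalgebra.centralizer F {QGHA.h q f g}) = QGHA.grading q f g 0 ∧
    QGHA.grading q f g 0 = ⨆ i : ℕ, QGHA.Mij q f g i i := by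
  exact ⟨(QGHA.centralizer_h q f g hf).trans (QGHA.grading_zero q f g).symm,
    QGHA.grading_zero q f g⟩
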